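/- Fix a strictly increasing sequence of positive integers (M_k)_{k≥0} with M_0 = 1. Let π : {0,1}^{ℕ≥1} → [0,1] be π(x) = Σ_{j≥1} x_j 2^{−j}. Let A = π(Ã), where Ã is the set of sequences x ∈ {0,1}^{ℕ≥1} such that for every even k ≥ 0 the sequence (x_j) is constant for j ∈ [M_k, M_{k+1}) ∩ ℕ, and let B = π(B̃), where B̃ is defined analogously with odd k. Then for every z ∈ [0,1) there exist a ∈ A and b ∈ B such that b − a = z. -/

import Mathlib

open Set Filter

/-- The binary coding map `π(x) = ∑_{j≥1} x_j 2^{−j}` (sequences indexed so that the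
`j`-th binary digit is `x j` for `j ≥ 1`). -/
noncomputable def binCode (x : ℕ → ℕ) : ℝ := ∑' j : ℕ, (x (j + 1) : ℝ) / 2 ^ (j + 1)

/-- The set of `{0,1}`-sequences that are constant on every block `[M_k, M_{k+1}) ∩ ℕ`
with `k % 2 = par`. -/
def blockConstant (M : ℕ → ℕ) (par : ℕ) : Set (ℕ → ℕ) :=
  {x | (∀ j, x j ≤ 1) ∧ ∀ k : ℕ, k % 2 = par →
    ∀ i j : ℕ, M k ≤ i → i < M (k + 1) → M k ≤ j → j < M (k + 1) → x i = x j}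

/-- `A = π(Ã)`: blocks with even `k` are constant. -/
def KanA (M : ℕ → ℕ) : Set ℝ := binCode '' blockConstant M 0

/-- `B = π(B̃)`: blocks with odd `k` are constant. -/
def KanB (M : ℕ → ℕ) : Set ℝ := binCode '' blockConstant M 1

theorem binCode_summable (x : ℕ → ℕ) (hx : ∀ j, x j ≤ 1) :
    Summable (fun j : ℕ => (x (j + 1) : ℝ) / 2 ^ (j + 1)) := by
  have h := Real.summable_ofDigitsTerm (b := 2)
    (digits := fun j => ⟨x (j + 1), Nat.lt_succ_of_le (hx (j + 1))⟩)
  refine h.congr ?_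
  intro j
  simp [Real.ofDigitsTerm, div_eq_mul_inv]

/-- **Decomposition step of Proposition 5.1.** For `(M_k)` strictly increasing with
`M_0 = 1`, every `z ∈ [0,1)` can be written as `z = b − a` with `a ∈ A`, `b ∈ B`. -/
theorem kan_difference_representation (M : ℕ → ℕ) (hM : StrictMono M) (hM0 : M 0 = 1)
    (z : ℝ) (hz : z ∈ Set.Ico (0 : ℝ) 1) :
    ∃ a ∈ KanA M, ∃ b ∈ KanB M, b - a = z := by
  classical
  let d : ℕ → ℕ := fun j => (Real.digits z 2 (j - 1) : ℕ)
  have hd : ∀ j, d j ≤ 1 := fun j => Nat.le_of_lt_succ (Real.digits z 2 (j - 1)).isLt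
  let P : ℕ → Prop := fun j => ∃ k, k % 2 = 0 ∧ M k ≤ j ∧ j < M (k + 1)
  let a : ℕ → ℕ := fun j => if P j then 0 else 1 - d j
  let b : ℕ → ℕ := fun j => if P j then d j else 1
  have ha : ∀ j, a j ≤ 1 := by
    intro j
    simp only [a]
    split_ifs <;> omega
  have hb : ∀ j, b j ≤ 1 := by
    intro j
    have := hd j
    simp only [b]
    split_ifs <;> omega
  have hP : ∀ k, k % 2 = 1 → ∀ j, M k ≤ j → j < M (k + 1) → ¬ P j := by
    rintro k hk j h1 h2 ⟨l, hl, h3, h4⟩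
    have h5 := hM.lt_iff_lt.1 (h1.trans_lt h4)
    have h6 := hM.lt_iff_lt.1 (h3.trans_lt h2)
    have : k = l := by omega
    omega
  refine ⟨binCode a, ⟨a, ⟨ha, ?_⟩, rfl⟩, binCode b, ⟨b, ⟨hb, ?_⟩, rfl⟩, ?_⟩
  · intro k hk i j h1 h2 h3 h4
    have hi : P i := ⟨k, hk, h1, h2⟩
    have hj : P j := ⟨k, hk, h3, h4⟩
    simp only [a, if_pos hi, if_pos hj]
  · intro k hk i j h1 h2 h3 h4
    have hi := hP k hk i h1 h2
    have hj := hP k hk j h3 h4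
    simp only [b, if_neg hi, if_neg hj]
  · unfold binCode
    rw [← (binCode_summable b hb).tsum_sub (binCode_summable a ha)]
    refine Eq.trans ?_ (Real.ofDigits_digits (b := 2) (by norm_num) hz)
    unfold Real.ofDigits
    refine tsum_congr fun j => ?_
    have h : (b (j + 1) : ℝ) - a (j + 1) = d (j + 1) := by
      have h1 : b (j + 1) = d (j + 1) + a (j + 1) := by
        have := hd (j + 1)
        simp only [a, b]
        split_ifs <;> omega
      rw [h1]
      push_cast
      ring
    rw [← sub_div, h]
    simp [Real.ofDigitsTerm, d, div_eq_mul_inv]
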